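/- arXiv:0902.4592 — 4 statements merged into one kernel-verified Lean document; each statement's English description precedes it below -/
import Mathlib

section
/- Let p be a prime number, V a nonzero finite-dimensional vector space over ℚ, and α : V → V a ℚ-linear automorphism with α^p = id. Suppose the complexification α_ℂ : ℂ ⊗_ℚ V → ℂ ⊗_ℚ V has exactly two distinct eigenvalues η and η̄, where η is not real and η̄ is its complex conjugate. Then p = 3. -/
open Module

/-- The eigenvalues of the scalar extension of `f` are the roots of the characteristic polynomial
of `f` in the larger field. -/
theorem hasEigenvalue_baseChange_iff_aeval_charpoly {K L V : Type*} [Field K] [Field L]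
    [Algebra K L] [AddCommGroup V] [Module K V] [FiniteDimensional K V]
    (f : Module.End K V) (μ : L) :
    Module.End.HasEigenvalue (LinearMap.baseChange L (f : V →ₗ[K] V)) μ ↔
      Polynomial.aeval μ f.charpoly = 0 := by
  rw [Module.End.hasEigenvalue_iff_isRoot_charpoly, LinearMap.charpoly_baseChange,
    Polynomial.IsRoot, Polynomial.eval_map_algebraMap]

/-- If a primitive `n`-th root of unity is an eigenvalue of a scalar extension of a rational
endomorphism, so are its powers with exponent coprime to `n`. -/
theorem IsPrimitiveRoot.hasEigenvalue_baseChange_pow {L V : Type*} [Field L] [CharZero L]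
    [AddCommGroup V] [Module ℚ V] [FiniteDimensional ℚ V] {f : Module.End ℚ V}
    {ζ : L} {n k : ℕ} (hζ : IsPrimitiveRoot ζ n) (hn : 0 < n) (hk : k.Coprime n)
    (h : Module.End.HasEigenvalue (LinearMap.baseChange L (f : V →ₗ[ℚ] V)) ζ) :
    Module.End.HasEigenvalue (LinearMap.baseChange L (f : V →ₗ[ℚ] V)) (ζ ^ k) := by
  rw [hasEigenvalue_baseChange_iff_aeval_charpoly] at h ⊢
  have hmin : minpoly ℚ ζ = minpoly ℚ (ζ ^ k) := by
    rw [← Polynomial.cyclotomic_eq_minpoly_rat hζ hn,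
      ← Polynomial.cyclotomic_eq_minpoly_rat (hζ.pow_of_coprime k hk) hn]
  rw [← minpoly.dvd_iff] at h ⊢
  rwa [← hmin]

/-- An eigenvalue of an endomorphism with `f ^ n = 1` is an `n`-th root of unity. -/
theorem Module.End.HasEigenvalue.pow_eq_one {K V : Type*} [Field K] [AddCommGroup V] [Module K V]
    {f : Module.End K V} {μ : K} (h : f.HasEigenvalue μ) {n : ℕ} (hf : f ^ n = 1) :
    μ ^ n = 1 := by
  obtain ⟨v, hv⟩ := h.exists_hasEigenvector
  have hpow := hv.pow_apply n
  rw [hf, Module.End.one_apply] at hpow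
  exact smul_left_injective K hv.2 (by simpa using hpow.symm)

/-- The linear-algebra content of Lemma 4.7 of the paper: if a `ℚ`-linear automorphism `α` of a
nonzero finite-dimensional `ℚ`-vector space satisfies `α ^ p = 1` for a prime `p`, and its
complexification has exactly the two distinct eigenvalues `η` and `conj η` with `η` non-real,
then `p = 3`. -/
theorem prime_order_with_two_conjugate_eigenvalues_eq_three
    {V : Type*} [AddCommGroup V] [Module ℚ V] [FiniteDimensional ℚ V] [Nontrivial V]
    (p : ℕ) (hp : p.Prime)
    (α : Module.End ℚ V) (hα : α ^ p = 1)
    (η : ℂ) (hη : η.im ≠ 0)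
    (h₁ : Module.End.HasEigenvalue (LinearMap.baseChange ℂ (α : V →ₗ[ℚ] V)) η)
    (h₂ : Module.End.HasEigenvalue (LinearMap.baseChange ℂ (α : V →ₗ[ℚ] V))
      ((starRingEnd ℂ) η))
    (h₃ : ∀ μ : ℂ, Module.End.HasEigenvalue (LinearMap.baseChange ℂ (α : V →ₗ[ℚ] V)) μ →
      μ = η ∨ μ = (starRingEnd ℂ) η) :
    p = 3 := by
  have hpow : η ^ p = 1 := h₁.pow_eq_one <| by
    rw [← LinearMap.baseChange_pow, hα, LinearMap.baseChange_one]
  have hne : η ≠ 1 := by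
    rintro rfl
    simp at hη
  have : Fact p.Prime := ⟨hp⟩
  have hprim : IsPrimitiveRoot η p := by
    simpa [orderOf_eq_prime hpow hne] using IsPrimitiveRoot.orderOf η
  have hp2 : p ≠ 2 := by
    rintro rfl
    rcases eq_or_eq_neg_of_sq_eq_sq η 1 (by rw [hpow, one_pow]) with rfl | rfl <;> simp at hη
  have hcop : Nat.Coprime 2 p := (Nat.coprime_primes Nat.prime_two hp).mpr hp2.symm
  rcases h₃ _ (hprim.hasEigenvalue_baseChange_pow hp.pos hcop h₁) with h | h
  · have hη0 : η ≠ 0 := hprim.ne_zero hp.ne_zero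
    exact absurd (mul_left_cancel₀ hη0 (by rw [← sq, h, mul_one])) hne
  · have hcube : η ^ 3 = 1 := by
      rw [pow_succ, h, Complex.conj_mul', hprim.norm'_eq_one hp.ne_zero]
      simp
    exact (Nat.prime_dvd_prime_iff_eq hp Nat.prime_three).mp (hprim.dvd_of_pow_eq_one 3 hcube)
end

section
/- Let V be a finite-dimensional vector space over ℚ and α : V → V a ℚ-linear automorphism with α⁹ = id whose complexification α_ℂ : ℂ ⊗_ℚ V → ℂ ⊗_ℚ V has at most two distinct eigenvalues. Then α³ = id. Equivalently: if some eigenvalue of α_ℂ is a primitive 9-th root of unity, then α_ℂ has at least 6 distinct eigenvalues, namely all six primitive 9-th roots of unity. -/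
open Module

open Polynomial in
/-- If the `n`-th cyclotomic polynomial divides the minimal polynomial of a rational endomorphism,
then every primitive `n`-th root of unity is an eigenvalue of its complexification. -/
theorem hasEigenvalue_baseChange_of_cyclotomic_dvd_minpoly
    {V : Type*} [AddCommGroup V] [Module ℚ V] [FiniteDimensional ℚ V]
    {α : Module.End ℚ V} {n : ℕ} (h : cyclotomic n ℚ ∣ minpoly ℚ α)
    {ζ : ℂ} (hζ : IsPrimitiveRoot ζ n) (hn : 0 < n) :
    Module.End.HasEigenvalue (LinearMap.baseChange ℂ (α : V →ₗ[ℚ] V)) ζ := by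
  rw [Module.End.hasEigenvalue_iff_isRoot_charpoly, LinearMap.charpoly_baseChange]
  have hdvd := Polynomial.map_dvd (algebraMap ℚ ℂ) (h.trans (LinearMap.minpoly_dvd_charpoly α))
  rw [map_cyclotomic] at hdvd
  exact (hζ.isRoot_cyclotomic hn).dvd hdvd

open Polynomial in
/-- An endomorphism killed by `X ^ p ^ (k + 1) - 1` whose minimal polynomial is not divisible by
the `p ^ (k + 1)`-th cyclotomic polynomial is killed by `X ^ p ^ k - 1`. -/
theorem pow_prime_pow_eq_one_of_not_cyclotomic_dvd_minpoly
    {A : Type*} [Ring A] [Algebra ℚ A] {a : A} {p k : ℕ} [hp : Fact p.Prime]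
    (ha : a ^ p ^ (k + 1) = 1) (h : ¬ cyclotomic (p ^ (k + 1)) ℚ ∣ minpoly ℚ a) :
    a ^ p ^ k = 1 := by
  have hdvd : minpoly ℚ a ∣ cyclotomic (p ^ (k + 1)) ℚ * (X ^ p ^ k - 1) := by
    rw [cyclotomic_prime_pow_mul_X_pow_sub_one]
    exact minpoly.dvd ℚ a (by simp [ha])
  have hcop : IsCoprime (cyclotomic (p ^ (k + 1)) ℚ) (minpoly ℚ a) :=
    (cyclotomic.irreducible_rat (pow_pos hp.out.pos _)).coprime_iff_not_dvd.2 h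
  have hroot := (minpoly.dvd_iff).1 (hcop.symm.dvd_of_dvd_mul_left hdvd)
  simpa [sub_eq_zero] using hroot

/-- The argument in Section 4 of the paper excluding order 9: a `ℚ`-linear automorphism `α` with
`α ^ 9 = 1` whose complexification has at most two distinct eigenvalues already satisfies
`α ^ 3 = 1`. -/
theorem order_nine_excluded
    {V : Type*} [AddCommGroup V] [Module ℚ V] [FiniteDimensional ℚ V]
    (α : Module.End ℚ V) (hα : α ^ 9 = 1)
    (htwo : ∃ a b : ℂ, ∀ μ : ℂ,
      Module.End.HasEigenvalue (LinearMap.baseChange ℂ (α : V →ₗ[ℚ] V)) μ → μ = a ∨ μ = b) :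
    α ^ 3 = 1 := by
  obtain ⟨a, b, hab⟩ := htwo
  have : Fact (Nat.Prime 3) := ⟨Nat.prime_three⟩
  refine pow_prime_pow_eq_one_of_not_cyclotomic_dvd_minpoly (p := 3) (k := 1) hα fun hdvd => ?_
  have hsub : primitiveRoots 9 ℂ ⊆ {a, b} := fun ζ hζ => by
    simpa using hab ζ (hasEigenvalue_baseChange_of_cyclotomic_dvd_minpoly hdvd
      (isPrimitiveRoot_of_mem_primitiveRoots hζ) (by norm_num))
  have hcard : (primitiveRoots 9 ℂ).card = 6 := by
    rw [Complex.card_primitiveRoots]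
    decide
  have hle := (Finset.card_le_card hsub).trans Finset.card_le_two
  omega
end

section
/- Let V be a nonzero finite-dimensional vector space over ℚ and α : V → V a ℚ-linear automorphism of finite order m, i.e., m is the smallest positive integer with α^m = id. If the complexification α_ℂ : ℂ ⊗_ℚ V → ℂ ⊗_ℚ V has at most two distinct eigenvalues, then m ∈ {1, 2, 3, 4, 6}. -/
open Module

theorem Nat.le_six_of_totient_le_two {d : ℕ} (h : d.totient ≤ 2) : d ≤ 6 := by
  by_contra! hd
  obtain ⟨x, hx1, hxd, hx⟩ : ∃ x, 1 < x ∧ x < d - 1 ∧ d.Coprime x := by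
    have key : ∀ k c : ℕ, (2 * k + 1).Coprime (2 ^ c) := fun k c =>
      Nat.Coprime.pow_right c (by simp)
    obtain hc | ⟨k, hk⟩ | ⟨k, hk⟩ : d % 2 = 1 ∨ (∃ k, d = 2 * (2 * k + 1) + 2 ^ 1) ∨
        ∃ k, d = 2 * (2 * k + 1) + 2 ^ 2 := by
      have : d % 2 = 1 ∨ d % 4 = 0 ∨ d % 4 = 2 := by omega
      rcases this with h | h | h
      · exact Or.inl h
      · exact Or.inr (Or.inl ⟨d / 4 - 1, by omega⟩)
      · exact Or.inr (Or.inr ⟨d / 4 - 1, by omega⟩)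
    · exact ⟨2, by omega, by omega, by simpa [Nat.odd_iff] using hc⟩
    · refine ⟨2 * k + 1, by omega, by omega, ?_⟩
      rw [hk, Nat.coprime_mul_right_add_left]
      exact (key k 1).symm
    · refine ⟨2 * k + 1, by omega, by omega, ?_⟩
      rw [hk, Nat.coprime_mul_right_add_left]
      exact (key k 2).symm
  have hpred : d.Coprime (d - 1) := by
    rw [Nat.coprime_self_sub_right (by omega)]
    simp
  have hsub : ({1, x, d - 1} : Finset ℕ) ⊆ {a ∈ Finset.range d | d.Coprime a} := by
    intro a ha
    simp only [Finset.mem_insert, Finset.mem_singleton] at ha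
    rw [Finset.mem_filter, Finset.mem_range]
    rcases ha with rfl | rfl | rfl
    · exact ⟨by omega, by simp⟩
    · exact ⟨by omega, hx⟩
    · exact ⟨by omega, hpred⟩
  have hcard : ({1, x, d - 1} : Finset ℕ).card = 3 :=
    Finset.card_eq_three.mpr ⟨1, x, d - 1, by omega, by omega, by omega, rfl⟩
  have := Finset.card_le_card hsub
  rw [hcard] at this
  rw [Nat.totient] at h
  omega

theorem LinearMap.hasEigenvalue_baseChange_of_aeval_minpoly_eq_zero {K L V : Type*} [Field K]
    [Field L] [Algebra K L] [AddCommGroup V] [Module K V] [FiniteDimensional K V]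
    (f : Module.End K V) {μ : L} (h : Polynomial.aeval μ (minpoly K f) = 0) :
    Module.End.HasEigenvalue (LinearMap.baseChange L (f : V →ₗ[K] V)) μ := by
  rw [Module.End.hasEigenvalue_iff_isRoot_charpoly, LinearMap.charpoly_baseChange,
    Polynomial.IsRoot, Polynomial.eval_map_algebraMap]
  obtain ⟨q, hq⟩ := LinearMap.minpoly_dvd_charpoly f
  rw [hq, map_mul, h, zero_mul]

/-- The linear-algebra content of the final Theorem of the paper: a `ℚ`-linear automorphism of
finite order `m` of a nonzero finite-dimensional `ℚ`-vector space whose complexification has at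
most two distinct eigenvalues has order `m ∈ {1, 2, 3, 4, 6}`. -/
theorem order_of_action_with_at_most_two_eigenvalues
    {V : Type*} [AddCommGroup V] [Module ℚ V] [FiniteDimensional ℚ V] [Nontrivial V]
    (α : Module.End ℚ V) (m : ℕ) (hm : 0 < m) (hαm : α ^ m = 1)
    (hmin : ∀ k : ℕ, 0 < k → α ^ k = 1 → m ≤ k)
    (htwo : ∃ a b : ℂ, ∀ μ : ℂ,
      Module.End.HasEigenvalue (LinearMap.baseChange ℂ (α : V →ₗ[ℚ] V)) μ → μ = a ∨ μ = b) :
    m = 1 ∨ m = 2 ∨ m = 3 ∨ m = 4 ∨ m = 6 := by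
  obtain ⟨a, b, hab⟩ := htwo
  have hmonic : (minpoly ℚ α).Monic := minpoly.monic (Algebra.IsIntegral.isIntegral α)
  have hdvd : minpoly ℚ α ∣ Polynomial.X ^ m - 1 := minpoly.dvd ℚ α (by simp [hαm])
  have hsep : (minpoly ℚ α).Separable :=
    (Polynomial.X_pow_sub_one_separable_iff.mpr (by exact_mod_cast hm.ne')).of_dvd hdvd
  have hcard : ((minpoly ℚ α).rootSet ℂ).ncard = (minpoly ℚ α).natDegree := by
    rw [← Nat.card_coe_set_eq, Nat.card_eq_fintype_card]
    exact Polynomial.card_rootSet_eq_natDegree hsep (IsAlgClosed.splits _)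
  have hdeg : (minpoly ℚ α).natDegree ≤ 2 := by
    rw [← hcard]
    refine (Set.ncard_le_ncard (t := {a, b}) fun μ hμ => ?_).trans ?_
    · exact hab μ (LinearMap.hasEigenvalue_baseChange_of_aeval_minpoly_eq_zero α
        (Polynomial.aeval_eq_zero_of_mem_rootSet hμ))
    · simpa using Set.ncard_insert_le a {b}
  have hpow : ∀ d, minpoly ℚ α ∣ Polynomial.X ^ d - 1 → α ^ d = 1 := fun d h => by
    simpa [sub_eq_zero] using (minpoly.dvd_iff.mp h)
  by_cases hall : ∀ μ ∈ (minpoly ℚ α).rootSet ℂ, μ ^ 2 = 1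
  · have : minpoly ℚ α ∣ Polynomial.X ^ 2 - 1 := by
      have hne : (Polynomial.X ^ 2 - 1 : Polynomial ℂ) ≠ 0 :=
        Polynomial.X_pow_sub_C_ne_zero two_pos 1
      rw [← Polynomial.map_dvd_map' (algebraMap ℚ ℂ), Polynomial.map_sub, Polynomial.map_pow,
        Polynomial.map_X, Polynomial.map_one,
        IsAlgClosed.dvd_iff_roots_le_roots (hmonic.map _).ne_zero hne,
        Multiset.le_iff_subset (Polynomial.nodup_roots hsep.map)]
      intro μ hμ
      have := hall μ (by simpa [Polynomial.mem_rootSet', Polynomial.mem_roots',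
        Polynomial.eval_map_algebraMap] using hμ)
      simp [Polynomial.mem_roots hne, this]
    have := hmin 2 two_pos (hpow 2 this)
    omega
  · push Not at hall
    obtain ⟨μ, hμ, hμ2⟩ := hall
    have hroot := Polynomial.aeval_eq_zero_of_mem_rootSet hμ
    have hμm : μ ^ m = 1 := by
      obtain ⟨q, hq⟩ := hdvd
      have := congrArg (Polynomial.aeval μ) hq
      simpa [hroot, sub_eq_zero] using this
    have hd : 0 < orderOf μ := orderOf_pos_iff.mpr (isOfFinOrder_iff_pow_eq_one.mpr ⟨m, hm, hμm⟩)
    have hcyc := Polynomial.cyclotomic_eq_minpoly_rat (IsPrimitiveRoot.orderOf μ) hd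
    have hcd : Polynomial.cyclotomic (orderOf μ) ℚ ∣ minpoly ℚ α := by
      rw [hcyc]; exact minpoly.dvd ℚ μ hroot
    have hφ : (orderOf μ).totient ≤ 2 := by
      rw [← Polynomial.natDegree_cyclotomic (orderOf μ) ℚ]
      exact (Polynomial.natDegree_le_of_dvd hcd hmonic.ne_zero).trans hdeg
    have h6 := Nat.le_six_of_totient_le_two hφ
    have h2 : ¬ orderOf μ ∣ 2 := fun h => hμ2 (orderOf_dvd_iff_pow_eq_one.mp h)
    have hle : orderOf μ ≤ m := Nat.le_of_dvd hm (orderOf_dvd_of_pow_eq_one hμm)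
    have hφ2 : (orderOf μ).totient = 2 ∧
        (orderOf μ = 3 ∨ orderOf μ = 4 ∨ orderOf μ = 6) := by
      generalize orderOf μ = d at hd h6 h2 hφ
      interval_cases d <;> revert h2 hφ <;> decide
    have heq : Polynomial.cyclotomic (orderOf μ) ℚ = minpoly ℚ α :=
      (Polynomial.eq_of_monic_of_dvd_of_natDegree_le (Polynomial.cyclotomic.monic _ ℚ) hmonic hcd
        (by rw [Polynomial.natDegree_cyclotomic, hφ2.1]; exact hdeg)).symm
    have := hmin _ hd (hpow _ (heq ▸ Polynomial.cyclotomic.dvd_X_pow_sub_one _ ℚ))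
    omega
end

section
/- Let n be a positive integer, N an n × n matrix with real entries, and W ⊆ ℂⁿ a complex linear subspace such that N·W ⊆ W and ℂⁿ = W ⊕ W̄, where W̄ = {v̄ : v ∈ W} is the image of W under coordinatewise complex conjugation. Then the rank of N over ℂ is even. -/
/-- Coordinatewise complex conjugation on `ℂⁿ`, as a `conj`-semilinear map. -/
noncomputable def conjVec (n : ℕ) : (Fin n → ℂ) →ₛₗ[starRingEnd ℂ] (Fin n → ℂ) where
  toFun v := fun i => (starRingEnd ℂ) (v i)
  map_add' v w := by funext i; simp
  map_smul' c v := by funext i; simp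

theorem conjVec_injective (n : ℕ) : Function.Injective (conjVec n) := fun v w h => by
  funext i
  exact (starRingEnd ℂ).injective (congrFun h i)

theorem finrank_map_conjVec {n : ℕ} (U : Submodule ℂ (Fin n → ℂ)) :
    Module.finrank ℂ (U.map (conjVec n)) = Module.finrank ℂ U := by
  let e := Submodule.equivMapOfInjective (conjVec n) (conjVec_injective n) U
  exact (congrArg Cardinal.toNat (rank_eq_of_equiv_equiv (starRingEnd ℂ) e.toAddEquiv
    (star_involutive (R := ℂ)).bijective fun r m => e.map_smulₛₗ r m)).symm

theorem mulVec_ofReal_conjVec {n : ℕ} (N : Matrix (Fin n) (Fin n) ℝ) (v : Fin n → ℂ) :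
    (N.map (Complex.ofReal : ℝ → ℂ)).mulVec (conjVec n v) =
      conjVec n ((N.map (Complex.ofReal : ℝ → ℂ)).mulVec v) := by
  funext i
  simp [conjVec, Matrix.mulVec, dotProduct]

/-- The key step in Section 2 of the paper ruling out maximally unipotent monodromy: a real
matrix `N` preserving a subspace `W ⊆ ℂⁿ` with `ℂⁿ = W ⊕ W̄` has even rank over `ℂ`. -/
theorem rank_even_of_preserves_subspace_compl_conj
    {n : ℕ} (N : Matrix (Fin n) (Fin n) ℝ)
    (W : Submodule ℂ (Fin n → ℂ))
    (hNW : ∀ v ∈ W, (N.map (Complex.ofReal : ℝ → ℂ)).mulVec v ∈ W)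
    (hcompl : IsCompl W (W.map (conjVec n))) :
    Even (N.map (Complex.ofReal : ℝ → ℂ)).rank := by
  let f := (N.map (Complex.ofReal : ℝ → ℂ)).mulVecLin
  let U := W.map f
  have hUW : U ≤ W := Submodule.map_le_iff_le_comap.mpr hNW
  have hconj : (W.map (conjVec n)).map f = U.map (conjVec n) := by
    ext x
    simp [U, f, Submodule.mem_map, mulVec_ofReal_conjVec]
  have hrange : LinearMap.range f = U ⊔ U.map (conjVec n) := by
    rw [LinearMap.range_eq_map, ← hcompl.sup_eq_top, Submodule.map_sup, hconj]
  have hdisj : U ⊓ U.map (conjVec n) = ⊥ :=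
    (hcompl.disjoint.mono hUW (Submodule.map_mono hUW)).eq_bot
  have hdim := Submodule.finrank_sup_add_finrank_inf_eq U (U.map (conjVec n))
  rw [hdisj, finrank_bot, add_zero, finrank_map_conjVec, ← hrange] at hdim
  exact ⟨_, hdim⟩
end
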